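/- arXiv:0908.2577 — 2 statements merged into one kernel-verified Lean document; each statement's English description precedes it below -/
import Mathlib

section
/- Let (W,S) be a Coxeter system with S finite. If the group W is infinite, then W contains an element of infinite order. -/
open Real

namespace CoxInf

variable {B W : Type*} [Fintype B] [DecidableEq B] [Group W]

/-- The Tits form. -/
noncomputable def bf (M : CoxeterMatrix B) : LinearMap.BilinForm ℝ (B → ℝ) :=
  Matrix.toBilin' (Matrix.of fun i j => -Real.cos (π / M i j))

/-- Simple roots. -/
def al (i : B) : B → ℝ := Pi.single i 1

theorem bf_al (M : CoxeterMatrix B) (i j : B) :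
    bf M (al i) (al j) = -Real.cos (π / M i j) := by
  simp [bf, al, Matrix.toBilin'_single]

theorem bf_al_self (M : CoxeterMatrix B) (i : B) : bf M (al i) (al i) = 1 := by
  simp [bf_al]

theorem bf_symm (M : CoxeterMatrix B) (u v : B → ℝ) : bf M u v = bf M v u := by
  simp only [bf, Matrix.toBilin'_apply]
  rw [Finset.sum_comm]
  refine Finset.sum_congr rfl fun i _ => Finset.sum_congr rfl fun j _ => ?_
  simp only [Matrix.of_apply]
  rw [M.symmetric]; ring

theorem two_bf (M : CoxeterMatrix B) {a : B → ℝ} (ha : bf M a a = 1) :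
    ((2 : ℝ) • bf M a) a = 2 := by simp [ha]

/-- The simple reflections. -/
noncomputable def sr (M : CoxeterMatrix B) (i : B) : (B → ℝ) ≃ₗ[ℝ] (B → ℝ) :=
  Module.reflection (two_bf M (bf_al_self M i))

theorem sr_apply (M : CoxeterMatrix B) (i : B) (v : B → ℝ) :
    sr M i v = v - (2 * bf M (al i) v) • al i := by
  simp [sr, Module.reflection_apply]

theorem sr_liftable (M : CoxeterMatrix B) : M.IsLiftable (sr M) := by
  intro i j
  by_cases hij : i = j
  · subst hij
    apply LinearEquiv.ext
    intro v
    simp only [sr_apply, bf_al_self, M.diagonal, pow_one, LinearEquiv.mul_apply, map_sub, map_smul,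
      LinearEquiv.coe_one, id_eq]
    module
  by_cases h0 : M i j = 0
  · simp [h0]
  have h1 : M i j ≠ 1 := M.off_diagonal i j hij
  by_cases h2 : M i j = 2
  · have e1 : bf M (al i) (al j) = 0 := by simp [bf_al, h2]
    have e2 : bf M (al j) (al i) = 0 := by rw [bf_symm, e1]
    rw [h2]
    apply LinearEquiv.ext
    intro v
    simp [pow_two, sr_apply, e1, e2, bf_al_self]
    module
  have h3 : 3 ≤ M i j := by omega
  set m := M i j with hm
  set φ : ℝ := 2 * π / m with hφ
  have hm0 : (0 : ℝ) < m := by positivity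
  have hs : Real.sin φ ≠ 0 := by
    apply ne_of_gt
    apply Real.sin_pos_of_pos_of_lt_pi
    · positivity
    · rw [hφ, div_lt_iff₀ hm0]
      have : (3 : ℝ) ≤ m := by exact_mod_cast h3
      nlinarith [Real.pi_pos]
  have hS : ∀ n : ℤ, (Polynomial.Chebyshev.S ℝ n).eval (2 * Real.cos φ)
      = Real.sin ((n + 1) * φ) / Real.sin φ := by
    intro n
    rw [eq_div_iff hs, Polynomial.Chebyshev.S_two_mul_real_cos]
  have ht : 2 * Real.cos φ =
      ((2 : ℝ) • bf M (al i)) (al j) * ((2 : ℝ) • bf M (al j)) (al i) - 2 := by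
    simp only [LinearMap.smul_apply, bf_al, smul_eq_mul, M.symmetric j i, ← hm]
    rw [hφ, mul_div_assoc, Real.cos_two_mul]; ring
  have hmφ : m * φ = 2 * π := by rw [hφ]; field_simp
  apply LinearEquiv.ext
  intro z
  unfold sr
  rw [Module.reflection_mul_reflection_pow_apply _ _ m z _ ht]
  simp only [hS]
  rcases Nat.even_or_odd' m with ⟨k, hk | hk⟩
  · have a1 : ((m : ℤ) - 2) / 2 = k - 1 := by omega
    have a2 : ((m : ℤ) - 1) / 2 = k - 1 := by omega
    rw [a1, a2]
    have : Real.sin (((((k : ℤ) - 1 : ℤ) : ℝ) + 1) * φ) = 0 := by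
      have : ((((k : ℤ) - 1 : ℤ) : ℝ) + 1) * φ = π := by
        push_cast
        rw [hk] at hmφ; push_cast at hmφ; linarith
      rw [this, Real.sin_pi]
    simp only [this]
    simp
  · have a1 : ((m : ℤ) - 2) / 2 = k - 1 := by omega
    have a2 : ((m : ℤ) - 1) / 2 = k := by omega
    have a3 : ((m : ℤ) - 3) / 2 = k - 1 := by omega
    have a4 : (m : ℤ) / 2 = k := by omega
    rw [a1, a2, a3, a4]
    have : Real.sin ((((k : ℤ) : ℝ) + 1) * φ) = - Real.sin (((((k : ℤ) - 1 : ℤ) : ℝ) + 1) * φ) := by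
      have : (((k : ℤ) : ℝ) + 1) * φ = 2 * π - ((((k : ℤ) - 1 : ℤ) : ℝ) + 1) * φ := by
        push_cast
        rw [hk] at hmφ; push_cast at hmφ; linarith
      rw [this, Real.sin_two_pi_sub]
    rw [this]
    simp [neg_div]

variable {M : CoxeterMatrix B} (cs : CoxeterSystem M W)

/-- The Tits representation. -/
noncomputable def rho : W →* ((B → ℝ) ≃ₗ[ℝ] (B → ℝ)) := cs.lift ⟨sr M, sr_liftable M⟩

theorem rho_simple (i : B) : rho cs (cs.simple i) = sr M i :=
  cs.lift_apply_simple (sr_liftable M) i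

theorem bf_sr (i : B) (u v : B → ℝ) : bf M (sr M i u) (sr M i v) = bf M u v := by
  simp only [sr_apply, map_sub, map_smul, LinearMap.sub_apply, LinearMap.smul_apply, smul_eq_mul,
    bf_al_self, bf_symm M u (al i)]
  ring

theorem bf_rho (w : W) (u v : B → ℝ) : bf M (rho cs w u) (rho cs w v) = bf M u v := by
  induction w using cs.simple_induction generalizing u v with
  | simple i => rw [rho_simple, bf_sr]
  | one => simp
  | mul a b ha hb => rw [map_mul]; simp only [LinearEquiv.mul_apply]; rw [ha, hb]

theorem rho_conj (w : W) (i : B) (v : B → ℝ) :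
    rho cs (w * cs.simple i * w⁻¹) v =
      v - (2 * bf M (rho cs w (al i)) v) • rho cs w (al i) := by
  have h : rho cs w (rho cs w⁻¹ v) = v := by
    rw [← LinearEquiv.mul_apply, ← map_mul]; simp
  rw [map_mul, map_mul, LinearEquiv.mul_apply, LinearEquiv.mul_apply, rho_simple, sr_apply,
    map_sub, map_smul, h]
  congr 3
  rw [← bf_rho cs w, h]

/-- If `u` is fixed and `g v = v + u` with `u ≠ 0`, infinite order. -/
theorem transvection {g : W} {u v : B → ℝ} (hu : u ≠ 0) (h1 : rho cs g u = u)
    (h2 : rho cs g v = v + u) : ¬ IsOfFinOrder g := by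
  intro h
  obtain ⟨n, hn, hg⟩ := isOfFinOrder_iff_pow_eq_one.1 h
  have key : ∀ k : ℕ, rho cs (g ^ k) v = v + (k : ℝ) • u := by
    intro k
    induction k with
    | zero => simp
    | succ k ih =>
      rw [pow_succ', map_mul, LinearEquiv.mul_apply, ih, map_add, map_smul, h1, h2]
      push_cast; module
  have := key n
  rw [hg] at this
  simp at this
  rcases this with h | h
  · omega
  · exact hu h

theorem M_ne_zero (cs : CoxeterSystem M W) (hW : ∀ w : W, IsOfFinOrder w) (i j : B) : M i j ≠ 0 := by
  intro h0
  have hij : i ≠ j := by rintro rfl; simp at h0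
  have e : bf M (al i) (al j) = -1 := by simp [bf_al, h0]
  have e' : bf M (al j) (al i) = -1 := by rw [bf_symm, e]
  refine transvection cs (g := cs.simple i * cs.simple j) (u := (2 : ℝ) • (al i + al j)) (v := al i)
    ?_ ?_ ?_ (hW _)
  · intro h
    have := congrFun h i
    simp [al, hij] at this
  · simp only [map_mul, LinearEquiv.mul_apply, rho_simple, sr_apply, map_sub, map_smul, map_add,
      bf_al_self, e, e']
    module
  · simp only [map_mul, LinearEquiv.mul_apply, rho_simple, sr_apply, map_sub, map_smul, map_add,
      bf_al_self, e, e']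
    module

/-- roots with equal pairing against everything coincide -/
theorem root_inj (hW : ∀ w : W, IsOfFinOrder w) (w w' : W) (i i' : B)
    (h : ∀ j, bf M (rho cs w (al i)) (al j) = bf M (rho cs w' (al i')) (al j)) :
    rho cs w (al i) = rho cs w' (al i') := by
  have hb : bf M (rho cs w (al i)) = bf M (rho cs w' (al i')) := by
    apply LinearMap.pi_ext'
    intro j
    apply LinearMap.ext_ring
    exact h j
  have hc := rho_conj cs w i
  have hc' := rho_conj cs w' i'
  have n1 : bf M (rho cs w (al i)) (rho cs w (al i)) = 1 := by rw [bf_rho, bf_al_self]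
  set a := rho cs w (al i)
  set a' := rho cs w' (al i')
  have n2 : bf M a a' = 1 := by rw [bf_symm, ← hb, n1]
  by_contra hne
  refine transvection cs (g := (w * cs.simple i * w⁻¹) * (w' * cs.simple i' * w'⁻¹))
    (u := (2 : ℝ) • (a - a')) (v := a) ?_ ?_ ?_ (hW _)
  · simpa [sub_eq_zero] using hne
  · rw [map_mul, LinearEquiv.mul_apply, hc', hc, ← hb]
    simp only [map_sub, map_smul, n1, n2]
    simp
  · rw [map_mul, LinearEquiv.mul_apply, hc', hc, ← hb]
    simp only [map_sub, map_smul, n1, n2]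
    simp
    module


open CoxeterSystem in
theorem dihedral (i j : B) (hij : i ≠ j) (k : ℕ) :
    Real.sin (π / M i j) • rho cs (cs.wordProd (alternatingWord i j k)) (al i) =
      if Even k then Real.sin ((k + 1) * (π / M i j)) • al i + Real.sin (k * (π / M i j)) • al j
      else Real.sin (k * (π / M i j)) • al i + Real.sin ((k + 1) * (π / M i j)) • al j := by
  set θ := π / (M i j : ℝ) with hθ
  have e1 : bf M (al i) (al j) = - Real.cos θ := by rw [bf_al]
  have e2 : bf M (al j) (al i) = - Real.cos θ := by rw [bf_symm, e1]
  have hrec : ∀ x : ℝ, Real.sin ((x + 1 + 1) * θ) =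
      2 * Real.cos θ * Real.sin ((x + 1) * θ) - Real.sin (x * θ) := by
    intro x
    have a : (x + 1 + 1) * θ = (x + 1) * θ + θ := by ring
    have b : x * θ = (x + 1) * θ - θ := by ring
    rw [a, b, Real.sin_add, Real.sin_sub]; ring
  induction k with
  | zero => simp [alternatingWord]
  | succ k ih =>
    rw [alternatingWord_succ', wordProd_cons, map_mul, LinearEquiv.mul_apply, ← map_smul, ih]
    by_cases hk : Even k
    · have hk' : ¬ Even (k + 1) := by simpa [Nat.even_add_one] using hk
      simp only [if_pos hk, if_neg hk', rho_simple, sr_apply, map_add, map_smul, bf_al_self, e1, e2]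
      push_cast
      rw [hrec]
      module
    · have hk' : Even (k + 1) := by simpa [Nat.even_add_one] using hk
      simp only [if_neg hk, if_pos hk', rho_simple, sr_apply, map_add, map_smul, bf_al_self, e1, e2]
      push_cast
      rw [hrec]
      module

open CoxeterSystem in
theorem positive (hM : ∀ i j, M i j ≠ 0) (n : ℕ) : ∀ (w : W) (i : B), cs.length w = n →
    cs.length w < cs.length (w * cs.simple i) → 0 ≤ rho cs w (al i) := by
  induction n using Nat.strong_induction_on with
  | _ n IH =>
  intro w i hn hlt
  by_cases hw : w = 1
  · subst hw
    simp [al]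
  obtain ⟨j, hj⟩ := cs.exists_rightDescent_of_ne_one hw
  have hij : i ≠ j := by
    rintro rfl
    have : cs.length (w * cs.simple i) < cs.length w := hj
    omega
  -- maximal decomposition
  let P : ℕ → Prop := fun k => ∃ v, w = v * cs.wordProd (alternatingWord i j k) ∧
    cs.length w = cs.length v + k
  have P1 : P 1 := by
    refine ⟨w * cs.simple j, by simp [alternatingWord], ?_⟩
    have := cs.isRightDescent_iff.1 hj
    omega
  have hbd : ∀ k, P k → k ≤ n := by
    rintro k ⟨v, -, h⟩
    omega
  classical
  have hk1 : 1 ≤ Nat.findGreatest P n := Nat.le_findGreatest (hbd 1 P1) P1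
  have hPk : P (Nat.findGreatest P n) := Nat.findGreatest_spec (hbd 1 P1) P1
  have hmax : ¬ P (Nat.findGreatest P n + 1) := fun h => by
    have := Nat.le_findGreatest (hbd _ h) h
    omega
  generalize Nat.findGreatest P n = k at hk1 hPk hmax
  obtain ⟨v, hwv, hlen⟩ := hPk
  -- ascent for the next letter
  have up1 : cs.length v < cs.length (v * cs.simple (if Even k then j else i)) := by
    by_contra hcon
    rcases cs.length_mul_simple v (if Even k then j else i) with h | h
    · omega
    · apply hmax
      refine ⟨v * cs.simple (if Even k then j else i), ?_, by omega⟩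
      rw [alternatingWord_succ', wordProd_cons, hwv]
      simp [mul_assoc]
  have up2 : cs.length v < cs.length (v * cs.simple (if Even k then i else j)) := by
    obtain ⟨k', rfl⟩ : ∃ k', k = k' + 1 := ⟨k - 1, by omega⟩
    by_contra hcon
    have hpar : (if Even (k' + 1) then i else j) = if Even k' then j else i := by
      by_cases h : Even k' <;> simp [Nat.even_add_one, h]
    rw [hpar] at hcon
    rcases cs.length_mul_simple v (if Even k' then j else i) with h | h
    · omega
    · have h1 : w = (v * cs.simple (if Even k' then j else i)) *
          cs.wordProd (alternatingWord i j k') := by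
        rw [hwv, alternatingWord_succ', wordProd_cons, mul_assoc]
      have h2 := cs.length_mul_le (v * cs.simple (if Even k' then j else i))
        (cs.wordProd (alternatingWord i j k'))
      have h3 := cs.length_wordProd_le (alternatingWord i j k')
      rw [length_alternatingWord] at h3
      rw [← h1] at h2
      omega
  have upi : cs.length v < cs.length (v * cs.simple i) := by
    by_cases hk : Even k
    · simpa [hk] using up2
    · simpa [hk] using up1
  have upj : cs.length v < cs.length (v * cs.simple j) := by
    by_cases hk : Even k
    · simpa [hk] using up1
    · simpa [hk] using up2
  have hi := IH (cs.length v) (by omega) v i rfl upi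
  have hjj := IH (cs.length v) (by omega) v j rfl upj
  -- k < m
  have hkm : k + 1 ≤ M i j := by
    by_contra hcon
    have hred : ¬ cs.IsReduced (alternatingWord j i (k + 1)) :=
      cs.not_isReduced_alternatingWord j i (hM _ _) (by rw [M.symmetric]; omega)
    have h3 := cs.length_wordProd_le (alternatingWord j i (k + 1))
    have h4 : cs.length (cs.wordProd (alternatingWord j i (k + 1))) ≠
      (alternatingWord j i (k + 1)).length := hred
    rw [length_alternatingWord] at h3 h4
    have h5 : w * cs.simple i = v * cs.wordProd (alternatingWord j i (k + 1)) := by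
      rw [alternatingWord_succ, wordProd_concat, hwv, mul_assoc]
    have h6 := cs.length_mul_le v (cs.wordProd (alternatingWord j i (k + 1)))
    rw [← h5] at h6
    omega
  have hm2 : (2 : ℝ) ≤ M i j := by
    have h0 := hM i j
    have h1 := M.off_diagonal i j hij
    have : 2 ≤ M i j := by omega
    exact_mod_cast this
  have hkm' : (k : ℝ) + 1 ≤ M i j := by exact_mod_cast hkm
  have nn : ∀ x : ℝ, 0 ≤ x → x ≤ M i j → 0 ≤ Real.sin (x * (π / M i j)) := by
    intro x hx hx'
    apply Real.sin_nonneg_of_nonneg_of_le_pi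
    · have := Real.pi_pos
      positivity
    · rw [mul_div_assoc', div_le_iff₀ (by linarith)]
      nlinarith [Real.pi_pos]
  have n1 := nn k (by positivity) (by linarith)
  have n2 := nn (k + 1) (by positivity) hkm'
  have hs : 0 < Real.sin (π / M i j) := by
    apply Real.sin_pos_of_pos_of_lt_pi
    · have := Real.pi_pos
      positivity
    · rw [div_lt_iff₀ (by linarith)]
      nlinarith [Real.pi_pos]
  have hd := congrArg (rho cs v) (dihedral cs i j hij k)
  rw [map_smul, ← LinearEquiv.mul_apply, ← map_mul, ← hwv] at hd
  have hfin : 0 ≤ Real.sin (π / M i j) • rho cs w (al i) := by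
    rw [hd]
    split_ifs
    · rw [map_add, map_smul, map_smul]
      exact add_nonneg (smul_nonneg n2 hi) (smul_nonneg n1 hjj)
    · rw [map_add, map_smul, map_smul]
      exact add_nonneg (smul_nonneg n1 hi) (smul_nonneg n2 hjj)
  intro b
  have := hfin b
  simp only [Pi.zero_apply, Pi.smul_apply, smul_eq_mul] at this
  exact nonneg_of_mul_nonneg_right this hs

theorem faithful (hM : ∀ i j, M i j ≠ 0) (w : W) (hw : ∀ i, rho cs w (al i) = al i) : w = 1 := by
  by_contra hne
  obtain ⟨j, hj⟩ := cs.exists_rightDescent_of_ne_one hne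
  have h1 : cs.length (w * cs.simple j) < cs.length w := hj
  have := positive cs hM _ (w * cs.simple j) j rfl (by simpa using h1)
  rw [map_mul, LinearEquiv.mul_apply, rho_simple, sr_apply, bf_al_self, map_sub, map_smul, hw] at this
  have := this j
  simp [al] at this

/-! ### Arithmetic -/

theorem cheb_norm (m : ℕ) (hm : m ≠ 0) (y : ℂ)
    (h : (Polynomial.Chebyshev.C ℂ m).eval y = 2) : IsIntegral ℤ y ∧ ‖y‖ ≤ 2 := by
  obtain ⟨x, hx⟩ := Complex.cos_surjective (y / 2)
  have hy : y = 2 * Complex.cos x := by rw [hx]; ring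
  have h2 := h
  rw [hy, Polynomial.Chebyshev.C_two_mul_complex_cos] at h2
  have h3 : Complex.cos ((m : ℂ) * x) = 1 := by
    push_cast at h2
    linear_combination h2 / 2
  obtain ⟨n, hn⟩ := Complex.cos_eq_one_iff.1 h3
  have hm' : (m : ℂ) ≠ 0 := by exact_mod_cast hm
  have hx2 : x = ((((2 * n : ℚ) / m : ℚ) : ℝ) * π : ℝ) := by
    push_cast
    field_simp
    rw [mul_comm] 
    linear_combination -hn
  constructor
  · rw [hy, hx2]
    have := Complex.isIntegral_two_mul_cos_rat_mul_pi ((2 * n : ℚ) / m)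
    convert this using 3
    push_cast
    ring
  · rw [hy, hx2, ← Complex.ofReal_cos, norm_mul, Complex.norm_real]
    have := Real.abs_cos_le_one ((((2 * n : ℚ) / m : ℚ) : ℝ) * π)
    simp only [Complex.norm_ofNat, Real.norm_eq_abs]
    linarith

theorem cheb_root (hW : ∀ w : W, IsOfFinOrder w) (w : W) (i j : B) :
    ∃ m : ℕ, m ≠ 0 ∧ (Polynomial.Chebyshev.C ℝ m).eval
      ((2 * bf M (rho cs w (al i)) (al j)) ^ 2 - 2) = 2 := by
  have hc := rho_conj cs w i
  have n1 : bf M (rho cs w (al i)) (rho cs w (al i)) = 1 := by rw [bf_rho, bf_al_self]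
  set a := rho cs w (al i)
  set x := bf M a (al j) with hx
  have hx' : bf M (al j) a = x := by rw [bf_symm]
  set g := (w * cs.simple i * w⁻¹) * cs.simple j with hg
  have hgv : ∀ v, rho cs g v = v - (2 * bf M (al j) v) • al j -
      (2 * (bf M a v - 2 * bf M (al j) v * x)) • a := by
    intro v
    rw [hg, map_mul, LinearEquiv.mul_apply, hc, rho_simple, sr_apply]
    simp [hx]
  have g1 : rho cs g (al j) = - al j + (2 * x) • a := by
    rw [hgv, bf_al_self, ← hx]; module
  have g2 : rho cs g (rho cs g (al j)) = ((2 * x) ^ 2 - 2) • rho cs g (al j) - al j := by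
    rw [g1, hgv]
    simp only [map_add, map_neg, map_smul, bf_al_self, hx', ← hx, n1, smul_eq_mul]
    module
  obtain ⟨m, hm, hgm⟩ := isOfFinOrder_iff_pow_eq_one.1 (hW g)
  refine ⟨m, by omega, ?_⟩
  have key : ∀ n : ℕ, (Polynomial.Chebyshev.C ℝ n).eval ((2 * x) ^ 2 - 2) =
      2 * bf M (al j) (rho cs (g ^ n) (al j)) ∧
      (Polynomial.Chebyshev.C ℝ (n + 1)).eval ((2 * x) ^ 2 - 2) =
      2 * bf M (al j) (rho cs (g ^ (n + 1)) (al j)) := by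
    intro n
    induction n with
    | zero =>
      simp [bf_al_self, g1, hx']
      ring
    | succ n ih =>
      obtain ⟨ih1, ih2⟩ := ih
      refine ⟨by exact_mod_cast ih2, ?_⟩
      have hr : rho cs (g ^ (n + 1 + 1)) (al j) =
          ((2 * x) ^ 2 - 2) • rho cs (g ^ (n + 1)) (al j) - rho cs (g ^ n) (al j) := by
        rw [pow_succ, pow_succ, mul_assoc, map_mul (rho cs) (g ^ n), LinearEquiv.mul_apply,
          map_mul (rho cs) g, LinearEquiv.mul_apply, g2, map_sub, map_smul,
          map_mul (rho cs) (g ^ n) g, LinearEquiv.mul_apply]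
      rw [hr]
      push_cast
      rw [add_assoc, one_add_one_eq_two, Polynomial.Chebyshev.C_add_two]
      simp only [Polynomial.eval_sub, Polynomial.eval_mul, Polynomial.eval_X, map_sub, map_smul,
        smul_eq_mul]
      rw [ih1, ih2]; ring
  rw [(key m).1, hgm]
  simp [bf_al_self]

/-- The field of definition. -/
noncomputable def KK (M : CoxeterMatrix B) : IntermediateField ℚ ℝ :=
  IntermediateField.adjoin ℚ (Set.range fun p : B × B => Real.cos (π / M p.1 p.2))

instance (M : CoxeterMatrix B) : NumberField (KK M) := by
  have : FiniteDimensional ℚ (KK M) := by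
    have : Finite (Set.range fun p : B × B => Real.cos (π / M p.1 p.2)) :=
      (Set.finite_range _).to_subtype
    apply IntermediateField.finiteDimensional_adjoin
    rintro _ ⟨p, rfl⟩
    have := Real.isAlgebraic_cos_rat_mul_pi (1 / (M p.1 p.2 : ℚ))
    have h : Real.cos (π / M p.1 p.2) = Real.cos (((1 / (M p.1 p.2 : ℚ) : ℚ) : ℝ) * π) := by
      congr 1; push_cast; ring
    simp only [h]
    exact ((IsFractionRing.isAlgebraic_iff ℤ ℚ ℝ).1 this).isIntegral
  exact { to_charZero := inferInstance, to_finiteDimensional := this }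

theorem cos_mem (M : CoxeterMatrix B) (i j : B) : Real.cos (π / M i j) ∈ KK M :=
  IntermediateField.subset_adjoin _ _ ⟨(i, j), rfl⟩

theorem bf_al_mem (M : CoxeterMatrix B) (i : B) (v : B → ℝ) (hv : ∀ b, v b ∈ KK M) :
    bf M v (al i) ∈ KK M := by
  simp only [bf, Matrix.toBilin'_apply]
  refine sum_mem fun a _ => sum_mem fun b _ => ?_
  refine mul_mem (mul_mem (hv _) (neg_mem (cos_mem M _ _))) ?_
  simp only [al, Pi.single_apply]
  split_ifs
  · exact one_mem _
  · exact zero_mem _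

theorem rho_mem (w : W) (v : B → ℝ) (hv : ∀ b, v b ∈ KK M) (b : B) : rho cs w v b ∈ KK M := by
  induction w using cs.simple_induction generalizing v b with
  | simple i =>
    rw [rho_simple, sr_apply, bf_symm]
    simp only [Pi.sub_apply, Pi.smul_apply, smul_eq_mul]
    refine sub_mem (hv _) (mul_mem (mul_mem ?_ (bf_al_mem M i v hv)) ?_)
    · exact ofNat_mem _ 2
    · simp only [al, Pi.single_apply]
      split_ifs
      · exact one_mem _
      · exact zero_mem _
  | one => simpa using hv b
  | mul x y hx hy =>
    rw [map_mul, LinearEquiv.mul_apply]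
    exact hx _ (fun b => hy _ hv b) b

theorem bf_root_mem (w : W) (i j : B) : 2 * bf M (rho cs w (al i)) (al j) ∈ KK M := by
  refine mul_mem (ofNat_mem _ 2) (bf_al_mem M j _ (rho_mem cs w _ ?_))
  intro b
  simp only [al, Pi.single_apply]
  split_ifs
  · exact one_mem _
  · exact zero_mem _

theorem finite_values (hW : ∀ w : W, IsOfFinOrder w) :
    {x : ℝ | ∃ w i j, x = bf M (rho cs w (al i)) (al j)}.Finite := by
  have hfin := NumberField.Embeddings.finite_of_norm_le (KK M) ℂ 2
  refine (hfin.image (fun x : KK M => (x : ℝ) / 2)).subset ?_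
  rintro _ ⟨w, i, j, rfl⟩
  obtain ⟨m, hm, h⟩ := cheb_root cs hW w i j
  refine ⟨⟨_, bf_root_mem cs w i j⟩, ⟨?_, ?_⟩, by simp⟩
  all_goals
    set x : KK M := ⟨_, bf_root_mem cs w i j⟩ with hx
    have hK : (Polynomial.Chebyshev.C (KK M) m).eval (x ^ 2 - 2) = 2 := by
      apply (algebraMap (KK M) ℝ).injective
      rw [← Polynomial.eval_map_apply, Polynomial.Chebyshev.map_C]
      rw [map_sub, map_pow, map_ofNat]
      exact h
    have hφ : ∀ φ : KK M →+* ℂ, IsIntegral ℤ ((φ x) ^ 2 - 2) ∧ ‖(φ x) ^ 2 - 2‖ ≤ 2 := by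
      intro φ
      apply cheb_norm m hm
      have := congrArg φ hK
      rw [← Polynomial.eval_map_apply, Polynomial.Chebyshev.map_C, map_sub, map_pow, map_ofNat] at this
      exact this
  · let φ : KK M →+* ℂ := Complex.ofRealHom.comp (algebraMap (KK M) ℝ)
    have h1 := (hφ φ).1
    have h2 : IsIntegral ℤ ((φ x) ^ 2) := by
      have : (φ x) ^ 2 = ((φ x) ^ 2 - 2) + ((2 : ℤ) : ℂ) := by push_cast; ring
      rw [this]
      exact h1.add (isIntegral_algebraMap (R := ℤ) (x := 2))
    have h3 : IsIntegral ℤ (φ x) := IsIntegral.of_pow (by norm_num) h2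
    exact (isIntegral_algHom_iff (φ.toIntAlgHom) φ.injective).1 h3
  · intro φ
    have h1 := (hφ φ).2
    have h2 : ‖(φ x) ^ 2‖ ≤ 4 := by
      have : (φ x) ^ 2 = ((φ x) ^ 2 - 2) + 2 := by ring
      rw [this]
      refine (norm_add_le _ _).trans ?_
      have : ‖(2 : ℂ)‖ = 2 := by simp
      linarith
    rw [norm_pow] at h2
    nlinarith [norm_nonneg (φ x)]

theorem finite_of_torsion (cs : CoxeterSystem M W) (hW : ∀ w : W, IsOfFinOrder w) : Finite W := by
  have hM := M_ne_zero cs hW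
  set F := {x : ℝ | ∃ w i j, x = bf M (rho cs w (al i)) (al j)} with hF
  have : Finite F := (finite_values cs hW).to_subtype
  let f : W → B → B → F := fun w i j => ⟨bf M (rho cs w (al i)) (al j), w, i, j, rfl⟩
  apply Finite.of_injective f
  intro w w' h
  have hr : ∀ i, rho cs w (al i) = rho cs w' (al i) := by
    intro i
    apply root_inj cs hW
    intro j
    exact congrArg Subtype.val (congrFun (congrFun h i) j)
  have := faithful cs hM (w'⁻¹ * w) (fun i => by
    rw [map_mul, LinearEquiv.mul_apply, hr, ← LinearEquiv.mul_apply, ← map_mul]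
    simp)
  exact (inv_mul_eq_one.1 this).symm

end CoxInf

/-- An infinite Coxeter group (with finite generating set S) contains an element
of infinite order. -/
theorem coxeter_infinite_exists_infinite_order
    {B W : Type*} [Group W] [Finite B] (M : CoxeterMatrix B)
    (cs : CoxeterSystem M W) (hW : Infinite W) :
    ∃ w : W, ¬ IsOfFinOrder w := by
  classical
  by_contra h
  push Not at h
  have := Fintype.ofFinite B
  have := CoxInf.finite_of_torsion cs h
  exact not_finite W
end

section
/- (Schur) Every finitely generated infinite subgroup of GL_n(ℂ) contains an element of infinite order. Equivalently, every finitely generated torsion subgroup of GL_n(ℂ) is finite. -/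
/-- The integers form a Jacobson ring. -/
lemma schur_int_jacobson : IsJacobsonRing ℤ := by
  rw [isJacobsonRing_iff_prime_eq]
  intro P hP
  by_cases h : P = ⊥
  · subst h
    rw [eq_bot_iff]
    intro x hx
    rw [Ideal.mem_jacobson_bot] at hx
    have h1 := hx x
    rw [Ideal.mem_bot]
    rw [Int.isUnit_iff] at h1
    rcases h1 with h1 | h1
    · have : x * x = 0 := by linarith
      simpa using this
    · nlinarith [mul_self_nonneg x]
  · have := hP.isMaximal h
    exact Ideal.jacobson_eq_self_of_isMaximal

/-- A field of finite type over the integers is finite of prime characteristic. -/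
lemma schur_finite_field (F : Type*) [Field F] [i : Algebra ℤ F] [Algebra.FiniteType ℤ F] :
    Finite F ∧ ∃ p : ℕ, p.Prime ∧ CharP F p := by
  obtain rfl : i = Ring.toIntAlgebra F := Subsingleton.elim _ _
  have := schur_int_jacobson
  have hfin : Module.Finite ℤ F := finite_of_finite_type_of_isJacobsonRing ℤ F
  obtain ⟨p, hp⟩ := CharP.exists F
  have hp0 : p ≠ 0 := by
    rintro rfl
    have : CharZero F := CharP.charP_to_charZero F
    have hinj : Function.Injective (algebraMap ℤ F) := by
      intro a b hab
      simpa using hab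
    exact Int.not_isField (isField_of_isIntegral_of_isField hinj (Field.toIsField F))
  refine ⟨?_, p, ?_, hp⟩
  · apply Module.finite_of_fg_torsion F
    intro x
    refine ⟨⟨(p : ℤ), mem_nonZeroDivisors_of_ne_zero (by exact_mod_cast hp0)⟩, ?_⟩
    show (p : ℤ) • x = 0
    simp
  · exact (CharP.char_is_prime_or_zero F p).resolve_right hp0

/-- An element of finite order prime to `p` which is trivial modulo a map to a field of
characteristic `p` is trivial. -/
lemma schur_trivial_of_congr {n : ℕ} {R F : Type*} [CommRing R] [IsDomain R] [Field F]
    (φ : R →+* F) (g : Matrix (Fin n) (Fin n) R) (hg : φ.mapMatrix g = 1) (N : ℕ)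
    (hN : (N : F) ≠ 0) (hpow : g ^ N = 1) : g = 1 := by
  have h1 : (g - 1) * (∑ i ∈ Finset.range N, g ^ i) = 0 := by
    rw [mul_geom_sum, hpow, sub_self]
  have h2 : φ.mapMatrix (∑ i ∈ Finset.range N, g ^ i) = (N : Matrix (Fin n) (Fin n) F) := by
    rw [map_sum]
    simp only [map_pow, hg, one_pow]
    simp
  have h3 : (∑ i ∈ Finset.range N, g ^ i).det ≠ 0 := by
    intro h
    have h4 := RingHom.map_det φ (∑ i ∈ Finset.range N, g ^ i)
    rw [h, h2, map_zero, ← Matrix.diagonal_natCast, Matrix.det_diagonal] at h4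
    rw [Finset.prod_const] at h4
    exact pow_ne_zero _ hN h4.symm
  have h5 := congrArg (fun M => M * (∑ i ∈ Finset.range N, g ^ i).adjugate) h1
  simp only [mul_assoc, Matrix.mul_adjugate, zero_mul, Matrix.mul_smul, mul_one] at h5
  exact sub_eq_zero.mp ((smul_eq_zero.mp h5).resolve_left h3)

/-- The entries of a matrix generate a ring over which it is defined. -/
lemma schur_mem_range {n : ℕ} (A : Subalgebra ℤ ℂ) (g : Matrix.GeneralLinearGroup (Fin n) ℂ)
    (h1 : ∀ i j, g.1 i j ∈ A) (h2 : ∀ i j, g⁻¹.1 i j ∈ A) :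
    g ∈ (Matrix.GeneralLinearGroup.map (n := Fin n) A.val.toRingHom).range := by
  have e1 : A.val.toRingHom.mapMatrix (Matrix.of fun i j => (⟨g.1 i j, h1 i j⟩ : A)) = g.1 := by
    ext i j; rfl
  have e2 : A.val.toRingHom.mapMatrix (Matrix.of fun i j => (⟨g⁻¹.1 i j, h2 i j⟩ : A))
      = g⁻¹.1 := by
    ext i j; rfl
  have hinj : Function.Injective (A.val.toRingHom.mapMatrix (m := Fin n)) :=
    Matrix.map_injective Subtype.val_injective
  refine ⟨⟨Matrix.of fun i j => (⟨g.1 i j, h1 i j⟩ : A),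
    Matrix.of fun i j => (⟨g⁻¹.1 i j, h2 i j⟩ : A), hinj ?_, hinj ?_⟩, ?_⟩
  · rw [map_mul, e1, e2, map_one]; exact g.mul_inv
  · rw [map_mul, e1, e2, map_one]; exact g.inv_mul
  · apply Units.ext; exact e1

lemma schur_key (n : ℕ) (H : Subgroup (Matrix.GeneralLinearGroup (Fin n) ℂ))
    (hfg : H.FG) (S : Set ℂ) (hS : S.Finite) :
    ∃ p : ℕ, p.Prime ∧ ((p : ℂ)⁻¹ ∉ S) ∧ ∃ K : Subgroup (Matrix.GeneralLinearGroup (Fin n) ℂ),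
      K.relIndex H ≠ 0 ∧ ∀ g ∈ K, ∀ N : ℕ, ¬ p ∣ N → g ^ N = 1 → g = 1 := by
  obtain ⟨T, hT⟩ := hfg
  let S' : Set ℂ := S ∪ ⋃ g ∈ T, ((Set.range fun x : Fin n × Fin n => g.1 x.1 x.2) ∪
    (Set.range fun x : Fin n × Fin n => g⁻¹.1 x.1 x.2))
  have hS' : S'.Finite := by
    refine hS.union (T.finite_toSet.biUnion fun g _ => ?_)
    exact (Set.finite_range _).union (Set.finite_range _)
  let A := Algebra.adjoin ℤ S'
  have hA : Algebra.FiniteType ℤ A :=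
    (Subalgebra.fg_iff_finiteType A).mp (Subalgebra.fg_def.mpr ⟨S', hS', rfl⟩)
  obtain ⟨m, hm⟩ := Ideal.exists_maximal A
  let _ : Field (A ⧸ m) := Ideal.Quotient.field m
  have hFT : Algebra.FiniteType ℤ (A ⧸ m) :=
    Algebra.FiniteType.of_surjective (Ideal.Quotient.mkₐ ℤ m) (Ideal.Quotient.mkₐ_surjective ℤ m)
  obtain ⟨hfin, p, hp, hchar⟩ := schur_finite_field (A ⧸ m)
  let φ : A →+* A ⧸ m := Ideal.Quotient.mk m
  let f := Matrix.GeneralLinearGroup.map (n := Fin n) A.val.toRingHom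
  let ψ := Matrix.GeneralLinearGroup.map (n := Fin n) φ
  have hf : Function.Injective f := by
    intro a b hab
    apply Units.ext
    exact Matrix.map_injective (f := A.val.toRingHom) Subtype.val_injective
      (congrArg Units.val hab)
  have hH : H ≤ f.range := by
    rw [← hT, Subgroup.closure_le]
    intro g hg
    apply schur_mem_range
    · intro i j
      exact Algebra.subset_adjoin (Or.inr (Set.mem_biUnion hg (Or.inl ⟨(i, j), rfl⟩)))
    · intro i j
      exact Algebra.subset_adjoin (Or.inr (Set.mem_biUnion hg (Or.inr ⟨(i, j), rfl⟩)))
  refine ⟨p, hp, ?_, ψ.ker.map f, ?_, ?_⟩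
  · intro hmem
    have h1 : (p : ℂ)⁻¹ ∈ A := Algebra.subset_adjoin (Or.inl hmem)
    have h2 : (p : A) * ⟨_, h1⟩ = 1 := by
      apply Subtype.ext
      have : (p : ℂ) ≠ 0 := by exact_mod_cast hp.ne_zero
      simpa using mul_inv_cancel₀ this
    have h3 := congrArg φ h2
    rw [map_mul, map_natCast, CharP.cast_eq_zero, zero_mul, map_one] at h3
    exact zero_ne_one h3
  · rw [← Subgroup.map_comap_eq_self hH, Subgroup.relIndex_map_map_of_injective _ _ hf,
      Subgroup.relIndex_ker]
    have : Finite (Matrix (Fin n) (Fin n) (A ⧸ m)) := by unfold Matrix; infer_instance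
    have : Finite (Matrix.GeneralLinearGroup (Fin n) (A ⧸ m)) :=
      Finite.of_injective _ Units.val_injective
    exact Nat.card_pos.ne'
  · rintro _ ⟨g, hg, rfl⟩ N hN hpow
    have h1 : g ^ N = 1 := hf (by rw [map_pow, hpow, map_one])
    have h2 : g.1 = 1 := by
      apply schur_trivial_of_congr φ g.1 (congrArg Units.val (MonoidHom.mem_ker.mp hg)) N
      · rwa [Ne, CharP.cast_eq_zero_iff (A ⧸ m) p]
      · exact congrArg Units.val h1
    have h3 : g = 1 := Units.ext h2
    rw [h3, map_one]

/-- (Schur) Every finitely generated infinite subgroup of GL_n(ℂ) contains an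
element of infinite order. -/
theorem schur_fg_infinite_linear_exists_infinite_order
    (n : ℕ) (H : Subgroup (Matrix.GeneralLinearGroup (Fin n) ℂ))
    (hfg : H.FG) (hinf : Infinite H) :
    ∃ g ∈ H, ¬ IsOfFinOrder g := by
  by_contra! hcon
  obtain ⟨p, hp, -, K, hK, hKt⟩ := schur_key n H hfg ∅ Set.finite_empty
  obtain ⟨q, hq, hqp, L, hL, hLt⟩ := schur_key n H hfg {(p : ℂ)⁻¹} (Set.finite_singleton _)
  have hne : q ≠ p := by
    rintro rfl
    exact hqp rfl
  have hidx := Subgroup.relIndex_inf_ne_zero hK hL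
  rw [← Subgroup.inf_relIndex_right] at hidx
  have hbot : K ⊓ L ⊓ H = ⊥ := by
    rw [eq_bot_iff]
    rintro g ⟨⟨hgK, hgL⟩, hgH⟩
    rw [Subgroup.mem_bot]
    obtain ⟨N, hN, hgN⟩ := isOfFinOrder_iff_pow_eq_one.mp (hcon g hgH)
    obtain ⟨a, M, hM, rfl⟩ := Nat.exists_eq_pow_mul_and_not_dvd hN.ne' p hp.ne_one
    have h1 : g ^ p ^ a = 1 := hKt _ (K.pow_mem hgK _) M hM (by rw [← pow_mul, hgN])
    refine hLt g hgL (p ^ a) ?_ h1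
    intro hdvd
    exact hne ((Nat.prime_dvd_prime_iff_eq hq hp).mp (hq.dvd_of_dvd_pow hdvd))
  rw [hbot, Subgroup.relIndex_bot_left] at hidx
  exact hidx Nat.card_eq_zero_of_infinite
end
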